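/- arXiv:1104.2776 — 10 statements merged into one kernel-verified Lean document; each statement's English description precedes it below -/
import Mathlib

section
/- Every q-topos is a regular category (it has finite limits, every kernel pair has a coequalizer, and regular epimorphisms are stable under pullback); consequently, in a q-topos the class of regular epimorphisms coincides with the class of strong epimorphisms. -/
open CategoryTheory CategoryTheory.Limits

universe w v u

namespace QToposPaper

variable {C : Type u} [Category.{v} C]

/-- A morphism `g` is left orthogonal to a morphism `m` if every commuting square from `g`
to `m` admits a unique diagonal filler. -/
def LeftOrthogonal {A B X Y : C} (g : A ⟶ B) (m : X ⟶ Y) : Prop :=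
  ∀ (u : A ⟶ X) (v : B ⟶ Y), u ≫ m = g ≫ v →
    ∃! l : B ⟶ X, g ≫ l = u ∧ l ≫ m = v

/-- `t : U ⟶ Ω` is a generic strong monomorphism (i.e. a representation of the presheaf of
strong subobjects, phrased via its universal element): `t` is a strong monomorphism and every
strong monomorphism is a pullback of `t` along a unique classifying map. -/
def IsStrongSubClassifier {U Ω : C} (t : U ⟶ Ω) : Prop :=
  StrongMono t ∧
    ∀ {S X : C} (m : S ⟶ X), StrongMono m →
      ∃! χ : X ⟶ Ω, ∃ top : S ⟶ U, IsPullback top m t χ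

/-- `mem : E ⟶ P ⨯ A` exhibits `P` as a representing object for the presheaf
`X ↦ StrongSub (X ⨯ A)`, phrased via its universal element: every strong monomorphism into
`X ⨯ A` is a pullback of `mem` along a unique map `X ⟶ P`. -/
def IsWeakPowerObject [HasBinaryProducts C] (A : C) {P E : C} (mem : E ⟶ P ⨯ A) : Prop :=
  StrongMono mem ∧
    ∀ {S X : C} (m : S ⟶ X ⨯ A), StrongMono m →
      ∃! χ : X ⟶ P, ∃ top : S ⟶ E, IsPullback top m mem (prod.map χ (𝟙 A))

/-- `mem : E ⟶ P ⨯ A` exhibits `P` as a power object of `A`: every monomorphism into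
`X ⨯ A` is a pullback of `mem` along a unique map `X ⟶ P`. -/
def IsPowerObject [HasBinaryProducts C] (A : C) {P E : C} (mem : E ⟶ P ⨯ A) : Prop :=
  Mono mem ∧
    ∀ {S X : C} (m : S ⟶ X ⨯ A), Mono m →
      ∃! χ : X ⟶ P, ∃ top : S ⟶ E, IsPullback top m mem (prod.map χ (𝟙 A))

/-- `t : U ⟶ Ω` is a subobject classifier: every monomorphism is a pullback of `t` along a
unique classifying map. -/
def IsMonoClassifier {U Ω : C} (t : U ⟶ Ω) : Prop :=
  Mono t ∧
    ∀ {S X : C} (m : S ⟶ X), Mono m →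
      ∃! χ : X ⟶ Ω, ∃ top : S ⟶ U, IsPullback top m t χ

/-- An object `Ω` is exponentiating if for every object `X` the presheaf `C(- ⨯ X, Ω)` is
representable (phrased via a universal element `ev`). -/
def IsExponentiating [HasBinaryProducts C] (Ω : C) : Prop :=
  ∀ X : C, ∃ (E : C) (ev : E ⨯ X ⟶ Ω), ∀ {Y : C} (f : Y ⨯ X ⟶ Ω),
    ∃! g : Y ⟶ E, prod.map g (𝟙 X) ≫ ev = f

/-- A strong equivalence relation on `A`: a pair `r₁ r₂ : R ⟶ A` such that
`⟨r₁, r₂⟩ : R ⟶ A ⨯ A` is a strong monomorphism which is an internal equivalence relation. -/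
structure IsStrongEquivRel [HasBinaryProducts C] [HasPullbacks C]
    {R A : C} (r₁ r₂ : R ⟶ A) : Prop where
  strongMono : StrongMono (prod.lift r₁ r₂)
  refl : ∃ d : A ⟶ R, d ≫ r₁ = 𝟙 A ∧ d ≫ r₂ = 𝟙 A
  symm : ∃ s : R ⟶ R, s ≫ r₁ = r₂ ∧ s ≫ r₂ = r₁
  trans : ∃ t : pullback r₂ r₁ ⟶ R,
    t ≫ r₁ = pullback.fst r₂ r₁ ≫ r₁ ∧ t ≫ r₂ = pullback.snd r₂ r₁ ≫ r₂

/-- `r₁, r₂` admits an effective quotient: a coequalizer `e` of `r₁, r₂` whose kernel pair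
is `(r₁, r₂)`. -/
def HasEffectiveQuotient {R A : C} (r₁ r₂ : R ⟶ A) : Prop :=
  ∃ (Q : C) (e : A ⟶ Q) (w : r₁ ≫ e = r₂ ≫ e),
    Nonempty (IsColimit (Cofork.ofπ e w)) ∧ IsPullback r₁ r₂ e e

/-- A q-topos: a category with finite limits such that (i) for every object `A` the presheaf
`X ↦ StrongSub (X ⨯ A)` is representable, (ii) every strong equivalence relation has an
effective quotient, and (iii) regular epimorphisms are stable under pullback. -/
class QTopos (C : Type u) [Category.{v} C] [HasFiniteLimits C] : Prop where
  weakPowerObject : ∀ A : C, ∃ (P E : C) (mem : E ⟶ P ⨯ A), IsWeakPowerObject A mem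
  effectiveQuotient : ∀ {R A : C} (r₁ r₂ : R ⟶ A),
    IsStrongEquivRel r₁ r₂ → HasEffectiveQuotient r₁ r₂
  regularEpiStable : ∀ {P X Y Z : C} (p : P ⟶ X) (q : P ⟶ Z) (f : X ⟶ Y) (g : Z ⟶ Y),
    IsPullback p q f g → Nonempty (RegularEpi g) → Nonempty (RegularEpi p)

/-- The poset of strong subobjects of `X`. -/
def StrongSub (X : C) : Type (max u v) := { S : Subobject X // StrongMono S.arrow }

instance (X : C) : PartialOrder (StrongSub X) := Subtype.partialOrder _

/-- An object `X` is coarse if every morphism into `X` extends (necessarily uniquely) along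
any morphism which is simultaneously a monomorphism and an epimorphism. -/
def Coarse (X : C) : Prop :=
  ∀ {A B : C} (f : A ⟶ B), Mono f → Epi f → ∀ g : A ⟶ X, ∃ h : B ⟶ X, f ≫ h = g

end QToposPaper

open QToposPaper CategoryTheory CategoryTheory.Limits

theorem kernelPair_isStrongEquivRel {C : Type u} [Category.{v} C] [HasFiniteLimits C]
    {R A B : C} (f : A ⟶ B) (r₁ r₂ : R ⟶ A) (hk : IsPullback r₁ r₂ f f) :
    IsStrongEquivRel r₁ r₂ where
  strongMono := by
    have lf : ∀ {W : C} (a b : W ⟶ A), prod.lift a b ≫ (prod.fst : A ⨯ A ⟶ A) = a :=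
      fun a b => prod.lift_fst a b
    have ls : ∀ {W : C} (a b : W ⟶ A), prod.lift a b ≫ (prod.snd : A ⨯ A ⟶ A) = b :=
      fun a b => prod.lift_snd a b
    have hw : prod.lift r₁ r₂ ≫ (prod.fst ≫ f) = prod.lift r₁ r₂ ≫ (prod.snd ≫ f) := by
      rw [← Category.assoc, ← Category.assoc, lf, ls, hk.w]
    refine RegularMono.strongMono
      { Z := B
        left := prod.fst ≫ f
        right := prod.snd ≫ f
        w := hw
        isLimit := Fork.IsLimit.mk _
          (fun s => hk.lift (s.ι ≫ prod.fst) (s.ι ≫ prod.snd)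
            (by rw [Category.assoc, Category.assoc]; exact s.condition)) ?_ ?_ }
    · intro s
      change _ ≫ prod.lift r₁ r₂ = s.ι
      apply Limits.prod.hom_ext
      · rw [Category.assoc, lf, hk.lift_fst]
      · rw [Category.assoc, ls, hk.lift_snd]
    · intro s m hm
      replace hm : m ≫ prod.lift r₁ r₂ = s.ι := hm
      apply hk.hom_ext
      · rw [hk.lift_fst, ← hm, Category.assoc, lf]
      · rw [hk.lift_snd, ← hm, Category.assoc, ls]
  refl := ⟨hk.lift (𝟙 A) (𝟙 A) rfl, hk.lift_fst _ _ _, hk.lift_snd _ _ _⟩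
  symm := ⟨hk.lift r₂ r₁ hk.w.symm, hk.lift_fst _ _ _, hk.lift_snd _ _ _⟩
  trans := by
    have c : pullback.fst r₂ r₁ ≫ r₂ = pullback.snd r₂ r₁ ≫ r₁ := pullback.condition
    have w : (pullback.fst r₂ r₁ ≫ r₁) ≫ f = (pullback.snd r₂ r₁ ≫ r₂) ≫ f := by
      rw [Category.assoc, Category.assoc, hk.w, ← hk.w, hk.w, ← Category.assoc, c,
        Category.assoc, hk.w]
    exact ⟨hk.lift _ _ w, hk.lift_fst _ _ _, hk.lift_snd _ _ _⟩

theorem qtopos_regular {C : Type u} [Category.{v} C] [h : HasFiniteLimits C] [QTopos C] :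
    Regular C :=
  { h with
    hasCoequalizer_of_isKernelPair := by
      intro X Y Z f g₁ g₂ hk
      obtain ⟨Q, e, w, ⟨hc⟩, _⟩ :=
        QTopos.effectiveQuotient _ _ (kernelPair_isStrongEquivRel f g₁ g₂ hk)
      exact ⟨⟨⟨_, hc⟩⟩⟩
    regularEpiIsStableUnderBaseChange :=
      { of_isPullback := by
          intro X Y Y' S f g f' g' sq hg
          exact ⟨QTopos.regularEpiStable _ _ _ _ sq.flip hg.1⟩ } }

/-- Every q-topos is a regular category: it has finite limits, every kernel pair has a
coequalizer, and regular epimorphisms are stable under pullback; consequently the class of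
regular epimorphisms coincides with the class of strong epimorphisms. -/
theorem qtopos_is_regular_and_regularEpi_iff_strongEpi
    {C : Type u} [Category.{v} C] [HasFiniteLimits C] [QTopos C] :
    HasFiniteLimits C ∧
    (∀ {A B : C} (f : A ⟶ B),
      HasCoequalizer (pullback.fst f f) (pullback.snd f f)) ∧
    (∀ {P X Y Z : C} (p : P ⟶ X) (q : P ⟶ Z) (f : X ⟶ Y) (g : Z ⟶ Y),
      IsPullback p q f g → Nonempty (RegularEpi g) → Nonempty (RegularEpi p)) ∧
    (∀ {X Y : C} (f : X ⟶ Y), Nonempty (RegularEpi f) ↔ StrongEpi f) := by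
  refine ⟨inferInstance, fun f => qtopos_regular.hasCoequalizer_of_isKernelPair
    (IsPullback.of_hasPullback f f), QTopos.regularEpiStable, ?_⟩
  intro X Y f
  constructor
  · rintro ⟨h⟩
    have : IsRegularEpi f := ⟨⟨h⟩⟩
    infer_instance
  · intro h
    have : Regular C := qtopos_regular
    exact (Regular.isRegularEpi_of_extremalEpi f).1
end

section
/- Let C be a category with finite limits. The presheaves X ↦ StrongSub(X × A) are representable for all objects A of C if and only if the presheaf X ↦ StrongSub(X) is representable by an exponentiating object, i.e. by an object Ω such that for every object X the presheaf C(- × X, Ω) is representable. -/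
open CategoryTheory CategoryTheory.Limits

universe w v u

namespace QToposPaper

lemma strongMono_of_isPullback {C : Type u} [Category.{v} C] {S X U Y : C}
    {top : S ⟶ U} {m : S ⟶ X} {t : U ⟶ Y} {χ : X ⟶ Y}
    (h : IsPullback top m t χ) (ht : StrongMono t) : StrongMono m := by
  have hm : Mono m := by
    constructor
    intro Z a b hab
    apply h.hom_ext
    · have := ht.mono
      rw [← cancel_mono t]
      simp only [Category.assoc, h.w]
      rw [← Category.assoc, hab, Category.assoc]
    · exact hab
  refine { mono := hm, rlp := ?_ }
  intro A B z hz
  have := ht.rlp z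
  constructor
  intro f g sq
  have sq' : CommSq (f ≫ top) z t (g ≫ χ) := ⟨by
    rw [Category.assoc, h.w, ← Category.assoc, sq.w, Category.assoc]⟩
  have e : h.lift sq'.lift g sq'.fac_right ≫ m = g := h.lift_snd _ _ _
  refine ⟨⟨⟨h.lift sq'.lift g sq'.fac_right, ?_, e⟩⟩⟩
  rw [← cancel_mono m, Category.assoc, e, sq.w]

lemma exists_isPullback_comp_iff {C : Type u} [Category.{v} C] {S X U Y E Z : C}
    {e : E ⟶ U} {n : E ⟶ Z} {t : U ⟶ Y} {ev : Z ⟶ Y} (h : IsPullback e n t ev)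
    (m : S ⟶ X) (k : X ⟶ Z) :
    (∃ top : S ⟶ E, IsPullback top m n k) ↔ ∃ top : S ⟶ U, IsPullback top m t (k ≫ ev) := by
  constructor
  · rintro ⟨a, ha⟩
    exact ⟨_, ha.paste_horiz h⟩
  · rintro ⟨a, ha⟩
    exact ⟨_, IsPullback.of_right' ha h⟩

end QToposPaper

open QToposPaper CategoryTheory CategoryTheory.Limits

/-- Let `C` be a category with finite limits. The presheaves `X ↦ StrongSub (X ⨯ A)` are
representable for all objects `A` if and only if the presheaf `X ↦ StrongSub X` is
representable by an exponentiating object. -/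
theorem weakPowerObjects_iff_strongSubClassifier_exponentiating
    {C : Type u} [Category.{v} C] [HasFiniteLimits C] :
    (∀ A : C, ∃ (P E : C) (mem : E ⟶ P ⨯ A), IsWeakPowerObject A mem) ↔
    (∃ (Ω U : C) (t : U ⟶ Ω), IsStrongSubClassifier t ∧ IsExponentiating Ω) := by
  constructor
  · intro H
    obtain ⟨Ω, U, mem, hs, hmem⟩ := H (⊤_ C)
    have hiso : ∀ X : C, IsIso (prod.fst : X ⨯ (⊤_ C) ⟶ X) := fun X =>
      ⟨prod.lift (𝟙 X) (terminal.from X), by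
        apply Limits.prod.hom_ext
        · rw [Category.assoc, prod.lift_fst, Category.comp_id, Category.id_comp]
        · exact Subsingleton.elim _ _, prod.lift_fst _ _⟩
    have hfst : IsPullback (𝟙 U) mem (mem ≫ prod.fst) prod.fst :=
      IsPullback.of_horiz_isIso ⟨by simp⟩
    have hinv : IsPullback (𝟙 U) (mem ≫ prod.fst) mem (inv prod.fst) :=
      IsPullback.of_horiz_isIso ⟨by simp⟩
    have hcl : IsStrongSubClassifier (mem ≫ prod.fst) := by
      refine ⟨strongMono_of_isPullback hinv hs, ?_⟩
      intro S X m hm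
      have h1 : IsPullback (𝟙 S) m (m ≫ inv (prod.fst : X ⨯ (⊤_ C) ⟶ X)) (inv prod.fst) :=
        IsPullback.of_horiz_isIso ⟨by simp⟩
      have h2 : IsPullback (𝟙 S) (m ≫ inv (prod.fst : X ⨯ (⊤_ C) ⟶ X)) m prod.fst :=
        IsPullback.of_horiz_isIso ⟨by simp⟩
      have key : ∀ χ : X ⟶ Ω, (∃ top : S ⟶ U, IsPullback top m (mem ≫ prod.fst) χ) ↔
          ∃ top : S ⟶ U, IsPullback top (m ≫ inv (prod.fst : X ⨯ (⊤_ C) ⟶ X)) mem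
            (prod.map χ (𝟙 _)) := by
        intro χ
        rw [exists_isPullback_comp_iff hfst, prod.map_fst]
        constructor
        · rintro ⟨a, ha⟩
          exact ⟨_, h2.paste_horiz ha⟩
        · rintro ⟨a, ha⟩
          have := h1.paste_horiz ha
          rw [IsIso.inv_hom_id_assoc] at this
          exact ⟨_, this⟩
      simp only [key]
      exact hmem _ (strongMono_of_isPullback h2 hm)
    refine ⟨Ω, U, mem ≫ prod.fst, hcl, ?_⟩
    intro X
    obtain ⟨P, E, memX, hsX, hX⟩ := H X
    obtain ⟨ev, ⟨e, he⟩, -⟩ := hcl.2 memX hsX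
    refine ⟨P, ev, ?_⟩
    intro Y f
    have hpb := IsPullback.of_hasPullback (mem ≫ prod.fst) f
    have hsm := strongMono_of_isPullback hpb hcl.1
    obtain ⟨g, hg, hgu⟩ := hX _ hsm
    refine ⟨g, ?_, ?_⟩
    · exact (hcl.2 _ hsm).unique ((exists_isPullback_comp_iff he _ _).1 hg) ⟨_, hpb⟩
    · intro g' hg'
      apply hgu
      rw [exists_isPullback_comp_iff he, hg']
      exact ⟨_, hpb⟩
  · rintro ⟨Ω, U, t, hcl, hexp⟩ A
    obtain ⟨P, ev, hev⟩ := hexp A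
    have he := IsPullback.of_hasPullback t ev
    refine ⟨P, _, pullback.snd t ev, strongMono_of_isPullback he hcl.1, ?_⟩
    intro S X m hm
    obtain ⟨χ, hχ, hχu⟩ := hcl.2 m hm
    obtain ⟨g, hg, hgu⟩ := hev χ
    refine ⟨g, ?_, ?_⟩
    · change ∃ top, _
      rw [exists_isPullback_comp_iff he, hg]
      exact hχ
    · intro g' hg'
      apply hgu
      apply hχu
      exact (exists_isPullback_comp_iff he _ _).1 hg'
end

section
/- In a q-topos, the class of strong monomorphisms coincides with the class of regular monomorphisms: every regular monomorphism is strong, and every strong monomorphism m : U ↣ A is the equalizer of its classifying map χ_m : A → Ω and the composite ⊤ ∘ !_A. -/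
open CategoryTheory CategoryTheory.Limits

universe w v u

open QToposPaper CategoryTheory CategoryTheory.Limits

theorem QToposPaper.aux_isPullback {C : Type u} [Category.{v} C] [HasFiniteLimits C]
    {P E : C} (mem : E ⟶ P ⨯ (⊤_ C)) [Mono mem] {X : C} (f : X ⟶ E) :
    IsPullback f (prod.lift (𝟙 X) (terminal.from X)) mem
      (prod.map (f ≫ mem ≫ prod.fst) (𝟙 (⊤_ C))) := by
  have : IsIso (prod.lift (𝟙 X) (terminal.from X)) :=
    ⟨prod.fst, prod.lift_fst _ _, by
      ext
      · rw [Category.assoc]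
        erw [prod.lift_fst]
        simp⟩
  refine IsPullback.of_vert_isIso_mono ⟨?_⟩
  ext
  · rw [Category.assoc, Category.assoc, prod.map_fst]
    erw [prod.lift_fst_assoc]
    simp

theorem QToposPaper.aux_regular {C : Type u} [Category.{v} C] [HasFiniteLimits C] [QTopos C]
    {X Y : C} (f : X ⟶ Y) (hf : StrongMono f) : Nonempty (RegularMono f) := by
  obtain ⟨P, E, mem, hm, hu⟩ := QTopos.weakPowerObject (⊤_ C)
  have hiso : ∀ X : C, IsIso (prod.lift (𝟙 X) (terminal.from X)) := fun X =>
    ⟨prod.fst, prod.lift_fst _ _, by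
      ext
      · rw [Category.assoc]
        erw [prod.lift_fst]
        simp⟩
  have hs : ∀ X : C, StrongMono (prod.lift (𝟙 X) (terminal.from X)) := fun X => by
    have := hiso X
    infer_instance
  have huniq : ∀ {X : C} (a b : X ⟶ E), a = b := by
    intro X a b
    have h := (hu _ (hs X)).unique ⟨a, QToposPaper.aux_isPullback mem a⟩
      ⟨b, QToposPaper.aux_isPullback mem b⟩
    rw [← cancel_mono mem]
    ext
    simpa using h
  obtain ⟨χ₀, ⟨r, -⟩, -⟩ := hu _ (hs (P ⨯ (⊤_ C)))
  have hsplit : RegularMono mem := by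
    have : IsSplitMono mem := ⟨⟨⟨r, huniq _ _⟩⟩⟩
    exact RegularMono.ofIsSplitMono mem
  have := hs Y
  have := hiso Y
  obtain ⟨χ, ⟨top, hp⟩, -⟩ := hu (f ≫ prod.lift (𝟙 Y) (terminal.from Y)) inferInstance
  have h1 : IsPullback (𝟙 X) f (f ≫ prod.lift (𝟙 Y) (terminal.from Y))
      (prod.lift (𝟙 Y) (terminal.from Y)) := IsPullback.of_horiz_isIso ⟨by simp⟩
  have h2 := h1.paste_horiz hp
  exact ⟨regularOfIsPullbackSndOfRegular hsplit h2.w h2.isLimit⟩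

/-- In a q-topos, strong monomorphisms coincide with regular monomorphisms: every regular
monomorphism is strong, and every strong monomorphism `m : U ⟶ A` is the equalizer of its
classifying map `χ_m : A ⟶ Ω` and the composite `!_A ≫ ⊤`. -/
theorem strongMono_iff_regularMono_and_strongMono_is_equalizer
    {C : Type u} [Category.{v} C] [HasFiniteLimits C] [QTopos C] :
    (∀ {X Y : C} (f : X ⟶ Y), StrongMono f ↔ Nonempty (RegularMono f)) ∧
    (∀ {T Ω : C} (t : T ⟶ Ω), IsStrongSubClassifier t → ∀ (hT : IsTerminal T)
      {U A : C} (m : U ⟶ A), StrongMono m →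
      ∀ χ : A ⟶ Ω, (∃ top : U ⟶ T, IsPullback top m t χ) →
        ∃ w : m ≫ χ = m ≫ (hT.from A ≫ t),
          Nonempty (IsLimit (Fork.ofι m w))) := by
  refine ⟨fun f => ⟨QToposPaper.aux_regular f, fun ⟨h⟩ => ?_⟩, ?_⟩
  · have : IsRegularMono f := ⟨⟨h⟩⟩
    infer_instance
  · rintro T Ω t ⟨ht, -⟩ hT U A m hm χ ⟨top, hp⟩
    have w : m ≫ χ = m ≫ (hT.from A ≫ t) := by
      rw [← hp.w, ← Category.assoc, hT.hom_ext top (m ≫ hT.from A)]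
    refine ⟨w, ⟨Fork.IsLimit.mk' _ fun s => ⟨hp.lift (hT.from _) s.ι ?_, ?_, ?_⟩⟩⟩
    · rw [s.condition, ← Category.assoc, hT.hom_ext (hT.from s.pt) (s.ι ≫ hT.from A)]
    · exact hp.lift_snd _ _ _
    · intro l hl
      rw [← cancel_mono m]
      exact hl.trans (hp.lift_snd _ _ _).symm
end

section
/- In a q-topos, the class of epimorphisms and the class of strong monomorphisms form an orthogonal factorization system: every morphism f factors as f = m ∘ e with e an epimorphism and m a strong monomorphism, m is the least strong subobject of the codomain through which f factors, and the class of morphisms left orthogonal to all strong monomorphisms is exactly the class of epimorphisms. -/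
open CategoryTheory CategoryTheory.Limits

universe w v u

open QToposPaper CategoryTheory CategoryTheory.Limits

namespace QToposPaper

variable {C : Type u} [Category.{v} C] [HasFiniteLimits C]

theorem strongMono_pb {P X Y Z : C} {p : P ⟶ X} {q : P ⟶ Z} {m : X ⟶ Y} {g : Z ⟶ Y}
    (h : IsPullback p q m g) (hm : StrongMono m) : StrongMono q := by
  have := hm.mono
  refine ⟨⟨fun a b hab => h.hom_ext ?_ hab⟩, ?_⟩
  · rw [← cancel_mono m, Category.assoc, Category.assoc, h.w, reassoc_of% hab]
  · intro A B z hz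
    have := hm.rlp z
    refine ⟨fun {u v} sq => ?_⟩
    have sq' : CommSq (u ≫ p) z m (v ≫ g) := ⟨by
      rw [Category.assoc, h.w, reassoc_of% sq.w]⟩
    have hl : sq'.lift ≫ m = v ≫ g := sq'.fac_right
    refine ⟨⟨⟨h.lift sq'.lift v hl, ?_, by simp⟩⟩⟩
    apply h.hom_ext
    · simp
    · simp [sq.w]

theorem equalizer_strong {X Y : C} (f g : X ⟶ Y) : StrongMono (equalizer.ι f g) := by
  infer_instance

theorem forall_exists [QTopos C] {S Z A : C} (m : S ⟶ Z ⨯ A) (hm : StrongMono m) :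
    ∃ (F : C) (j : F ⟶ Z), StrongMono j ∧ ∀ {W : C} (z : W ⟶ Z),
      (∃ k, k ≫ j = z) ↔ ∃ k, k ≫ m = prod.map z (𝟙 A) := by
  obtain ⟨P, E, mem, hmem, hP⟩ := QTopos.weakPowerObject A
  have := hmem.mono
  obtain ⟨χ, ⟨t, ht⟩, -⟩ := hP m hm
  obtain ⟨τ, ⟨s, hs⟩, -⟩ := hP (𝟙 (Z ⨯ A)) inferInstance
  refine ⟨_, equalizer.ι χ τ, inferInstance, fun {W} z => ⟨?_, ?_⟩⟩
  · rintro ⟨k, rfl⟩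
    have e : prod.map (k ≫ equalizer.ι χ τ) (𝟙 A) ≫ prod.map χ (𝟙 A)
        = prod.map (k ≫ equalizer.ι χ τ) (𝟙 A) ≫ prod.map τ (𝟙 A) := by
      rw [prod.map_map, prod.map_map, Category.assoc, Category.assoc, equalizer.condition]
    have w := hs.w
    rw [Category.id_comp] at w
    exact ⟨ht.lift (prod.map (k ≫ equalizer.ι χ τ) (𝟙 A) ≫ s) _
      (by rw [e, Category.assoc, w]), ht.lift_snd _ _ _⟩
  · rintro ⟨k, hk⟩
    have key : ∀ (x : W ⟶ P) (top : W ⨯ A ⟶ E), top ≫ mem = prod.map x (𝟙 A) →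
        ∃ top, IsPullback top (𝟙 (W ⨯ A)) mem (prod.map x (𝟙 A)) := fun x top h =>
      ⟨top, ⟨⟨by simp [h]⟩, ⟨PullbackCone.IsLimit.mk _ (fun c => c.snd)
        (fun c => by rw [← cancel_mono mem, Category.assoc, h, c.condition])
        (fun c => by simp) (fun c l _ h2 => by simpa using h2)⟩⟩⟩
    have w := hs.w
    rw [Category.id_comp] at w
    have e : z ≫ χ = z ≫ τ := (hP (𝟙 (W ⨯ A)) inferInstance).unique
      (key _ (k ≫ t) (by rw [Category.assoc, ht.w, reassoc_of% hk]; simp))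
      (key _ (prod.map z (𝟙 A) ≫ s) (by rw [Category.assoc, w]; simp))
    exact ⟨equalizer.lift z e, by simp⟩

theorem least_exists [QTopos C] {X Y : C} (f : X ⟶ Y) :
    ∃ (I : C) (e : X ⟶ I) (m : I ⟶ Y), StrongMono m ∧ e ≫ m = f ∧
      ∀ {I' : C} (e' : X ⟶ I') (m' : I' ⟶ Y), StrongMono m' → e' ≫ m' = f →
        ∃ k : I ⟶ I', k ≫ m' = m := by
  obtain ⟨P, E, mem, hmem, hP⟩ := QTopos.weakPowerObject Y
  have h1 := IsPullback.of_hasPullback mem (prod.map (𝟙 P) f)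
  obtain ⟨T, j, hj, hT⟩ := forall_exists _ (strongMono_pb h1 hmem)
  have h2 := IsPullback.of_hasPullback mem
    (prod.lift (prod.snd ≫ j) prod.fst : Y ⨯ T ⟶ P ⨯ Y)
  obtain ⟨I, m, hm, hI⟩ := forall_exists _ (strongMono_pb h2 hmem)
  have hf : ∃ k, k ≫ m = f := by
    rw [hI]
    obtain ⟨k, hk⟩ := (hT j).1 ⟨𝟙 _, by simp⟩
    refine ⟨h2.lift (prod.lift prod.snd prod.fst ≫ k ≫ pullback.fst _ _)
      (prod.map f (𝟙 T)) ?_, h2.lift_snd _ _ _⟩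
    rw [Category.assoc, Category.assoc, h1.w, reassoc_of% hk]
    ext <;> simp
  obtain ⟨e, he⟩ := hf
  refine ⟨I, e, m, hm, he, ?_⟩
  intro I' e' m' hm' hf'
  have h3 := IsPullback.of_hasPullback m' (prod.snd : I ⨯ Y ⟶ Y)
  obtain ⟨χ, ⟨t, ht⟩, -⟩ := hP _ (strongMono_pb h3 hm')
  obtain ⟨c, hc⟩ : ∃ c, c ≫ j = χ := by
    rw [hT]
    refine ⟨h1.lift (h3.lift (prod.snd ≫ e') (prod.map (𝟙 I) f) (by simp [hf']) ≫ t)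
      (prod.map χ (𝟙 X)) ?_, h1.lift_snd _ _ _⟩
    rw [Category.assoc, ht.w, h3.lift_snd_assoc]
    simp
  obtain ⟨k, hk⟩ := (hI m).1 ⟨𝟙 _, by simp⟩
  have e1 : (prod.lift (𝟙 I) c ≫ k ≫ pullback.fst _ _) ≫ mem =
      prod.lift (𝟙 I) m ≫ prod.map χ (𝟙 Y) := by
    rw [Category.assoc, Category.assoc, h2.w, reassoc_of% hk]
    apply prod.hom_ext
    · simp only [Category.assoc, prod.lift_fst, prod.map_snd_assoc, prod.lift_snd_assoc,
        prod.map_fst, prod.lift_fst_assoc, Category.id_comp, hc]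
    · simp only [Category.assoc, prod.lift_snd, prod.map_fst, prod.lift_fst_assoc,
        prod.map_snd, Category.id_comp, Category.comp_id]
  refine ⟨ht.lift _ _ e1 ≫ pullback.fst _ _, ?_⟩
  rw [Category.assoc, h3.w, ht.lift_snd_assoc, prod.lift_snd]

end QToposPaper

/-- In a q-topos, epimorphisms and strong monomorphisms form an orthogonal factorization
system: every morphism `f` factors as an epimorphism followed by a strong monomorphism, the
strong monomorphism part is the least strong subobject of the codomain through which `f`
factors, and the morphisms left orthogonal to all strong monomorphisms are exactly the
epimorphisms. -/
theorem epi_strongMono_factorization_system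
    {C : Type u} [Category.{v} C] [HasFiniteLimits C] [QTopos C] :
    (∀ {X Y : C} (f : X ⟶ Y), ∃ (I : C) (e : X ⟶ I) (m : I ⟶ Y),
      Epi e ∧ StrongMono m ∧ e ≫ m = f ∧
      ∀ {I' : C} (e' : X ⟶ I') (m' : I' ⟶ Y), StrongMono m' → e' ≫ m' = f →
        ∃ k : I ⟶ I', k ≫ m' = m) ∧
    (∀ {X Y : C} (g : X ⟶ Y),
      (∀ {A B : C} (m : A ⟶ B), StrongMono m → LeftOrthogonal g m) ↔ Epi g) := by
  refine ⟨fun {X Y} f => ?_, fun {X Y} g => ⟨fun h => ⟨fun {Z} a b hab => ?_⟩, ?_⟩⟩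
  · obtain ⟨I, e, m, hm, he, hl⟩ := least_exists f
    refine ⟨I, e, m, ⟨fun {Z} a b hab => ?_⟩, hm, he, hl⟩
    have := hm.mono
    obtain ⟨k, hk⟩ := hl (equalizer.lift e hab) (equalizer.ι a b ≫ m)
      (strongMono_comp _ _) (by simp [he])
    have hk' : k ≫ equalizer.ι a b = 𝟙 I := by
      rw [← cancel_mono m]; simpa using hk
    rw [← Category.id_comp a, ← Category.id_comp b, ← hk', Category.assoc, Category.assoc,
      equalizer.condition]
  · obtain ⟨l, ⟨-, hl⟩, -⟩ := h (equalizer.ι a b) inferInstance (equalizer.lift g hab) (𝟙 Y)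
      (by simp)
    rw [← Category.id_comp a, ← Category.id_comp b, ← hl, Category.assoc, Category.assoc,
      equalizer.condition]
  · intro hg A B m hm u v huv
    have := hm.mono
    have := hm.rlp g
    have sq : CommSq u g m v := ⟨huv⟩
    refine ⟨sq.lift, ⟨sq.fac_left, sq.fac_right⟩, fun l hl => ?_⟩
    rw [← cancel_mono m, hl.2, sq.fac_right]
end

section
/- In a q-topos, epimorphisms are stable under pullback: if the square with sides p, q, f, g is a pullback and g is an epimorphism, then p is an epimorphism. -/
open CategoryTheory CategoryTheory.Limits

universe w v u

open QToposPaper CategoryTheory CategoryTheory.Limits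

/-- In a q-topos, epimorphisms are stable under pullback. -/
theorem epi_stable_under_pullback
    {C : Type u} [Category.{v} C] [HasFiniteLimits C] [QTopos C]
    {P X Y Z : C} (p : P ⟶ X) (q : P ⟶ Z) (f : X ⟶ Y) (g : Z ⟶ Y)
    (h : IsPullback p q f g) (hg : Epi g) : Epi p := by
  have hs : IsSplitMono (prod.lift f (𝟙 X)) :=
    IsSplitMono.mk' ⟨prod.snd, by simp [prod.lift_fst, prod.lift_snd]⟩
  have hss : StrongMono (prod.lift f (𝟙 X)) := inferInstance
  refine ⟨fun {B} u v huv => ?_⟩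
  have hi : StrongMono (equalizer.ι u v) := inferInstance
  have his : StrongMono (equalizer.ι u v ≫ prod.lift f (𝟙 X)) := strongMono_comp _ _
  obtain ⟨W, E, mem, hmem, hW⟩ := QTopos.weakPowerObject X
  have hpb1 : IsPullback p (prod.lift q p) (prod.lift f (𝟙 X)) (prod.map g (𝟙 X)) := by
    refine ⟨⟨?_⟩, ⟨PullbackCone.IsLimit.mk _
      (fun c => h.lift c.fst (c.snd ≫ prod.fst) ?_) ?_ ?_ ?_⟩⟩
    · ext
      · simp [h.w, prod.lift_fst, prod.lift_snd]
      · simp [prod.lift_fst, prod.lift_snd]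
    · have := c.condition =≫ prod.fst
      simpa [prod.lift_fst, prod.lift_snd] using this
    · intro c
      simp [prod.lift_fst, prod.lift_snd]
    · intro c
      have := c.condition =≫ prod.snd
      ext
      · simp [prod.lift_fst, prod.lift_snd]
      · simpa [prod.lift_fst, prod.lift_snd] using this
    · intro c m h1 h2
      apply h.hom_ext
      · simpa [prod.lift_fst, prod.lift_snd] using h1
      · simp [← h2, prod.lift_fst, prod.lift_snd]
  have hpb2 : IsPullback (equalizer.lift p huv) (prod.lift q p)
      (equalizer.ι u v ≫ prod.lift f (𝟙 X)) (prod.map g (𝟙 X)) := by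
    refine ⟨⟨?_⟩, ⟨PullbackCone.IsLimit.mk _
      (fun c => hpb1.lift (c.fst ≫ equalizer.ι u v) c.snd ?_) ?_ ?_ ?_⟩⟩
    · rw [← Category.assoc, equalizer.lift_ι, hpb1.w]
    · simpa [prod.lift_fst, prod.lift_snd] using c.condition
    · intro c
      apply equalizer.hom_ext
      rw [Category.assoc, equalizer.lift_ι, hpb1.lift_fst]
    · intro c
      rw [hpb1.lift_snd]
    · intro c m h1 h2
      apply hpb1.hom_ext
      · rw [hpb1.lift_fst, ← h1, Category.assoc, equalizer.lift_ι]
      · rw [hpb1.lift_snd, h2]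
  have hm : StrongMono (prod.lift q p) := by
    have : Mono (prod.lift q p) :=
      ⟨fun a b hab => hpb1.hom_ext
        (by simpa [prod.lift_fst, prod.lift_snd] using hab =≫ prod.snd) hab⟩
    refine ⟨this, fun {A B} z hz => ?_⟩
    have := hss.rlp z
    exact hpb1.hasLiftingProperty z
  obtain ⟨χ₁, ⟨t₁, h₁⟩, -⟩ := hW _ hss
  obtain ⟨χ₂, ⟨t₂, h₂⟩, -⟩ := hW _ his
  have e₁ := hpb1.paste_horiz h₁
  have e₂ := hpb2.paste_horiz h₂
  rw [prod.map_map, Category.comp_id] at e₁ e₂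
  have heq : χ₁ = χ₂ := by
    rw [← cancel_epi g]
    exact (hW _ hm).unique ⟨_, e₁⟩ ⟨_, e₂⟩
  subst heq
  have hl : h₂.lift t₁ (prod.lift f (𝟙 X)) h₁.w ≫ equalizer.ι u v = 𝟙 X := by
    have := h₂.lift_snd t₁ (prod.lift f (𝟙 X)) h₁.w =≫ prod.snd
    simpa [prod.lift_fst, prod.lift_snd] using this
  rw [← Category.id_comp u, ← Category.id_comp v, ← hl, Category.assoc, Category.assoc,
    equalizer.condition]
end

section
/- Let f : A → B be a morphism in a q-topos that is both a monomorphism and an epimorphism. Then the pullback map f* : StrongSub(B) → StrongSub(A) between the posets of strong subobjects is an isomorphism of posets. -/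
open CategoryTheory CategoryTheory.Limits

universe w v u

open QToposPaper CategoryTheory CategoryTheory.Limits

namespace QToposPaper

lemma strongMono_of_isPullback_s6 {C : Type u} [Category.{v} C] {P X Y Z : C}
    {p : P ⟶ X} {q : P ⟶ Z} {f : X ⟶ Y} {g : Z ⟶ Y} (h : IsPullback p q f g)
    (hf : StrongMono f) : StrongMono q where
  mono := ⟨fun a b w => h.hom_ext (by
    rw [← cancel_mono f]; simp only [Category.assoc, h.w]; simp only [← Category.assoc, w]) w⟩
  rlp := by
    intro A B z hz
    constructor
    intro u v sq
    have w : (u ≫ p) ≫ f = z ≫ v ≫ g := by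
      rw [Category.assoc, h.w, ← Category.assoc, sq.w, Category.assoc]
    have sq' : CommSq (u ≫ p) z f (v ≫ g) := ⟨w⟩
    refine ⟨⟨⟨h.lift sq'.lift v sq'.fac_right, ?_, by simp⟩⟩⟩
    apply h.hom_ext
    · simp
    · simp [sq.w]

lemma strongMono_split {C : Type u} [Category.{v} C] {X Y : C} (m : X ⟶ Y) (r : Y ⟶ X)
    (h : m ≫ r = 𝟙 X) : StrongMono m := by
  have : IsSplitMono m := ⟨⟨⟨r, h⟩⟩⟩
  infer_instance

lemma epi_of_isPullback {C : Type u} [Category.{v} C] [HasFiniteLimits C] [QTopos C]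
    {P X Y Z : C} {p : P ⟶ X} {q : P ⟶ Z} {f : X ⟶ Y} {g : Z ⟶ Y} (h : IsPullback p q f g)
    (hg : Epi g) : Epi p := by
  constructor
  intro W a b hab
  obtain ⟨Pw, E, mem, hmem, hP⟩ := QTopos.weakPowerObject X
  let e := equalizer.ι a b
  let l : P ⟶ equalizer a b := equalizer.lift p hab
  have hl : l ≫ e = p := equalizer.lift_ι _ _
  let m1 : X ⟶ Y ⨯ X := prod.lift f (𝟙 X)
  have sm1 : StrongMono m1 := strongMono_split m1 prod.snd (by simp [m1, prod.lift_fst, prod.lift_snd, prod.lift_fst_assoc, prod.lift_snd_assoc])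
  have se : StrongMono e := inferInstance
  have sm2 : StrongMono (e ≫ m1) := strongMono_comp _ _
  have pb1 : IsPullback p (prod.lift q p) m1 (prod.map g (𝟙 X)) := by
    refine ⟨⟨by ext <;> simp [m1, h.w, prod.lift_fst, prod.lift_snd, prod.lift_fst_assoc, prod.lift_snd_assoc]⟩, ⟨PullbackCone.IsLimit.mk _
      (fun s => h.lift s.fst (s.snd ≫ prod.fst) ?_) ?_ ?_ ?_⟩⟩
    · have := s.condition =≫ prod.fst
      simpa [m1, prod.lift_fst, prod.lift_snd, prod.lift_fst_assoc, prod.lift_snd_assoc] using this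
    · intro s; simp
    · intro s
      have := s.condition =≫ prod.snd
      have hs : s.fst = s.snd ≫ prod.snd := by
        simpa [m1, prod.lift_fst, prod.lift_snd] using this
      ext <;> simp [hs, prod.lift_fst, prod.lift_snd]
    · intro s m hm1 hm2
      apply h.hom_ext
      · simp [hm1]
      · simp [← hm2, prod.lift_fst, prod.lift_snd]
  have pb2 : IsPullback l (prod.lift q p) (e ≫ m1) (prod.map g (𝟙 X)) := by
    refine ⟨⟨by rw [← Category.assoc, hl, pb1.w]⟩, ⟨PullbackCone.IsLimit.mk _
      (fun s => pb1.lift (s.fst ≫ e) s.snd (by simpa using s.condition)) ?_ ?_ ?_⟩⟩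
    · intro s
      rw [← cancel_mono e, Category.assoc, hl]; exact pb1.lift_fst _ _ _
    · intro s; exact pb1.lift_snd _ _ _
    · intro s m hm1 hm2
      apply pb1.hom_ext
      · simp [← hm1, hl]
      · rw [hm2]; exact (pb1.lift_snd _ _ _).symm
  have sl := strongMono_of_isPullback_s6 pb1 sm1
  obtain ⟨χ1, ⟨t1, h1⟩, -⟩ := hP m1 sm1
  obtain ⟨χ2, ⟨t2, h2⟩, -⟩ := hP (e ≫ m1) sm2
  have key : g ≫ χ1 = g ≫ χ2 := by
    apply (hP (prod.lift q p) sl).unique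
    · refine ⟨p ≫ t1, ?_⟩
      have := pb1.paste_horiz h1
      simpa using this
    · refine ⟨l ≫ t2, ?_⟩
      have := pb2.paste_horiz h2
      simpa using this
  rw [cancel_epi] at key
  subst key
  have hj : h2.lift t1 m1 h1.w ≫ e ≫ m1 = m1 := h2.lift_snd _ _ _
  have hj' : h2.lift t1 m1 h1.w ≫ e = 𝟙 X := by
    rw [← cancel_mono m1]; simpa using hj
  calc a = (h2.lift t1 m1 h1.w ≫ e) ≫ a := by rw [hj', Category.id_comp]
    _ = (h2.lift t1 m1 h1.w ≫ e) ≫ b := by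
      rw [Category.assoc, Category.assoc, equalizer.condition]
    _ = b := by rw [hj', Category.id_comp]

lemma isPullback_of_factor {C : Type u} [Category.{v} C] {M X Y : C} (m : M ⟶ X) [Mono m]
    (g : Y ⟶ X) (b : Y ⟶ M) (hb : b ≫ m = g) : IsPullback b (𝟙 Y) m g := by
  refine ⟨⟨by simp [hb]⟩, ⟨PullbackCone.IsLimit.mk _ (fun s => s.snd) ?_ ?_ ?_⟩⟩
  · intro s
    rw [← cancel_mono m, Category.assoc, hb, s.condition]
  · intro s; simp
  · intro s m' _ h2; simpa using h2

lemma exists_forall {C : Type u} [Category.{v} C] [HasFiniteLimits C] [QTopos C]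
    {X A M : C} (m : M ⟶ X ⨯ A) (hm : StrongMono m) :
    ∃ (K : C) (κ : K ⟶ X), StrongMono κ ∧ ∀ {Y : C} (g : Y ⟶ X),
      (∃ a : Y ⟶ K, a ≫ κ = g) ↔ ∃ b : Y ⨯ A ⟶ M, b ≫ m = prod.map g (𝟙 A) := by
  obtain ⟨Pw, E, mem, hmem, hP⟩ := QTopos.weakPowerObject A
  obtain ⟨χ, ⟨t1, h1⟩, -⟩ := hP m hm
  obtain ⟨τ, ⟨t2, h2⟩, -⟩ := hP (𝟙 (X ⨯ A)) inferInstance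
  refine ⟨equalizer χ τ, equalizer.ι χ τ, inferInstance, ?_⟩
  intro Y g
  constructor
  · rintro ⟨a, rfl⟩
    refine ⟨h1.lift (prod.map (a ≫ equalizer.ι χ τ) (𝟙 A) ≫ t2)
      (prod.map (a ≫ equalizer.ι χ τ) (𝟙 A)) ?_, h1.lift_snd _ _ _⟩
    rw [Category.assoc, h2.w]
    simp [show equalizer.ι χ τ ≫ χ = equalizer.ι χ τ ≫ τ from equalizer.condition χ τ]
  · rintro ⟨b, hb⟩
    have key : g ≫ χ = g ≫ τ := by
      apply (hP (𝟙 (Y ⨯ A)) inferInstance).unique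
      · refine ⟨b ≫ t1, isPullback_of_factor _ _ _ ?_⟩
        rw [Category.assoc, h1.w, ← Category.assoc, hb]; simp
      · refine ⟨prod.map g (𝟙 A) ≫ t2, isPullback_of_factor _ _ _ ?_⟩
        rw [Category.assoc, h2.w]; simp
    exact ⟨equalizer.lift g key, equalizer.lift_ι _ _⟩

lemma exists_strong_image {C : Type u} [Category.{v} C] [HasFiniteLimits C] [QTopos C]
    {S B : C} (h : S ⟶ B) : ∃ (T : C) (i : T ⟶ B) (s : S ⟶ T), StrongMono i ∧ s ≫ i = h ∧
      ∀ {U : C} (j : U ⟶ B), StrongMono j → (∃ s : S ⟶ U, s ≫ j = h) →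
        ∃ t : T ⟶ U, t ≫ j = i := by
  obtain ⟨Pw, E, mem, hmem, hP⟩ := QTopos.weakPowerObject B
  have pb1 := IsPullback.of_hasPullback mem (prod.map (𝟙 Pw) h)
  obtain ⟨K, κ, hκ, HK⟩ := exists_forall _ (strongMono_of_isPullback_s6 pb1 hmem)
  let r : B ⨯ K ⟶ Pw ⨯ B := prod.lift (prod.snd ≫ κ) prod.fst
  have pb2 := IsPullback.of_hasPullback mem r
  obtain ⟨T, i, hi, HT⟩ := exists_forall _ (strongMono_of_isPullback_s6 pb2 hmem)
  obtain ⟨b, hb⟩ := (HK κ).1 ⟨𝟙 _, by simp⟩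
  obtain ⟨s, hs⟩ := (HT h).2 ⟨pb2.lift (prod.lift prod.snd prod.fst ≫ b ≫ pullback.fst _ _)
    (prod.map h (𝟙 K)) (by
      rw [Category.assoc, Category.assoc, pb1.w, ← Category.assoc b, hb]
      ext <;> simp [r, prod.lift_fst, prod.lift_snd, prod.lift_fst_assoc, prod.lift_snd_assoc]), pb2.lift_snd _ _ _⟩
  refine ⟨T, i, s, hi, hs, ?_⟩
  rintro U j hj ⟨s', hs'⟩
  let j' : U ⟶ (⊤_ C) ⨯ B := prod.lift (terminal.from U) j
  have hj' : StrongMono j' := by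
    have : StrongMono (j' ≫ (prod.snd : (⊤_ C) ⨯ B ⟶ B)) := by simpa [j', prod.lift_fst, prod.lift_snd, prod.lift_fst_assoc, prod.lift_snd_assoc] using hj
    exact strongMono_of_strongMono j' prod.snd
  obtain ⟨χ, ⟨t, ht⟩, -⟩ := hP j' hj'
  obtain ⟨a, ha⟩ := (HK χ).2 ⟨pb1.lift (prod.snd ≫ s' ≫ t) (prod.map χ (𝟙 S)) (by
    rw [Category.assoc, Category.assoc, ht.w]
    ext
    · simp only [j', prod.lift_map, Category.assoc, prod.lift_fst,
        prod.map_fst, Category.comp_id]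
      simp only [← Category.assoc]
      congr 1
      exact Subsingleton.elim _ _
    · simp [j', hs', prod.lift_fst, prod.lift_snd, prod.lift_fst_assoc, prod.lift_snd_assoc]), pb1.lift_snd _ _ _⟩
  obtain ⟨c, hc⟩ := (HT i).1 ⟨𝟙 _, by simp⟩
  refine ⟨ht.lift (prod.lift (𝟙 T) (terminal.from T ≫ a) ≫ c ≫ pullback.fst _ _)
    (prod.lift (terminal.from T) i) ?_, ?_⟩
  · rw [Category.assoc, Category.assoc, pb2.w, ← Category.assoc c, hc]
    ext <;> simp [r, ha, prod.lift_fst, prod.lift_snd, prod.lift_fst_assoc, prod.lift_snd_assoc]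
  · have := ht.lift_snd (prod.lift (𝟙 T) (terminal.from T ≫ a) ≫ c ≫ pullback.fst _ _)
      (prod.lift (terminal.from T) i) (by
        rw [Category.assoc, Category.assoc, pb2.w, ← Category.assoc c, hc]
        ext <;> simp [r, ha, prod.lift_fst, prod.lift_snd, prod.lift_fst_assoc, prod.lift_snd_assoc])
    have := this =≫ prod.snd
    simpa [j', prod.lift_fst, prod.lift_snd, prod.lift_fst_assoc, prod.lift_snd_assoc] using this

lemma exists_epi_strongMono {C : Type u} [Category.{v} C] [HasFiniteLimits C] [QTopos C]
    {S B : C} (h : S ⟶ B) : ∃ (T : C) (i : T ⟶ B) (s : S ⟶ T),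
      StrongMono i ∧ Epi s ∧ s ≫ i = h := by
  obtain ⟨T, i, s, hi, hs, H⟩ := exists_strong_image h
  refine ⟨T, i, s, hi, ⟨fun {W} a b hab => ?_⟩, hs⟩
  obtain ⟨t, ht⟩ := H (equalizer.ι a b ≫ i) (strongMono_comp _ _)
    ⟨equalizer.lift s hab, by rw [← Category.assoc, equalizer.lift_ι, hs]⟩
  have ht' : t ≫ equalizer.ι a b = 𝟙 T := by
    rw [← cancel_mono i]; simpa using ht
  calc a = (t ≫ equalizer.ι a b) ≫ a := by rw [ht', Category.id_comp]
    _ = (t ≫ equalizer.ι a b) ≫ b := by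
      rw [Category.assoc, Category.assoc, equalizer.condition]
    _ = b := by rw [ht', Category.id_comp]

end QToposPaper

/-- Let `f : A ⟶ B` be a morphism in a q-topos that is both a monomorphism and an
epimorphism. Then the pullback map `f* : StrongSub B → StrongSub A` is an isomorphism of
posets: there is an order isomorphism `StrongSub B ≃o StrongSub A` which sends every strong
subobject to its pullback along `f`. -/
theorem strongSub_pullback_orderIso_of_mono_epi
    {C : Type u} [Category.{v} C] [HasFiniteLimits C] [QTopos C]
    {A B : C} (f : A ⟶ B) (hm : Mono f) (he : Epi f) :
    ∃ e : StrongSub B ≃o StrongSub A,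
      ∀ T : StrongSub B, ∃ top : ((e T).1 : C) ⟶ (T.1 : C),
        IsPullback top (e T).1.arrow T.1.arrow f := by
  have pb : ∀ T : Subobject B, IsPullback (Subobject.pullbackπ f T)
      ((Subobject.pullback f).obj T).arrow T.arrow f := fun T => Subobject.isPullback f T
  let F : StrongSub B → StrongSub A := fun T =>
    ⟨(Subobject.pullback f).obj T.1, strongMono_of_isPullback_s6 (pb T.1) T.2⟩
  have hle : ∀ T U : StrongSub B, F T ≤ F U ↔ T ≤ U := by
    intro T U
    constructor
    · intro h
      have h' : (Subobject.pullback f).obj T.1 ≤ (Subobject.pullback f).obj U.1 := h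
      have ep : Epi (Subobject.pullbackπ f T.1) := epi_of_isPullback (pb T.1) he
      have := U.2
      have sq : CommSq (Subobject.ofLE _ _ h' ≫ Subobject.pullbackπ f U.1)
          (Subobject.pullbackπ f T.1) U.1.arrow T.1.arrow := ⟨by
        rw [Category.assoc, (pb U.1).w, ← Category.assoc, Subobject.ofLE_arrow, (pb T.1).w]⟩
      have le : T.1 ≤ U.1 := Subobject.le_of_comm sq.lift sq.fac_right
      exact le
    · intro h
      have h' : T.1 ≤ U.1 := h
      have le : (Subobject.pullback f).obj T.1 ≤ (Subobject.pullback f).obj U.1 :=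
        (Subobject.pullback f).monotone h'
      exact le
  have hsurj : Function.Surjective F := by
    rintro ⟨S, hS⟩
    obtain ⟨T, i, s, hi, hs, hsi⟩ := exists_epi_strongMono (S.arrow ≫ f)
    have hT : StrongMono (Subobject.mk i).arrow := by
      rw [← Subobject.underlyingIso_hom_comp_eq_mk]
      exact strongMono_comp _ _
    refine ⟨⟨Subobject.mk i, hT⟩, Subtype.ext ?_⟩
    have q := IsPullback.of_hasPullback i f
    let l : (S : C) ⟶ pullback i f := q.lift s S.arrow hsi
    have hl1 : l ≫ pullback.fst i f = s := q.lift_fst _ _ _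
    have hl2 : l ≫ pullback.snd i f = S.arrow := q.lift_snd _ _ _
    have hl : StrongMono l := by
      have : StrongMono (l ≫ pullback.snd i f) := by rw [hl2]; exact hS
      exact strongMono_of_strongMono l (pullback.snd i f)
    have sq : IsPullback l (𝟙 _) (pullback.fst i f) s :=
      isPullback_of_factor _ _ _ hl1
    have el : Epi l := epi_of_isPullback sq hs
    have il : IsIso l := isIso_of_epi_of_strongMono l
    change (Subobject.pullback f).obj (Subobject.mk i) = S
    rw [Subobject.pullback_obj_mk q]
    exact Subobject.mk_eq_of_comm _ (asIso l).symm (by simp [← hl2])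
  let e : StrongSub B ↪o StrongSub A := OrderEmbedding.ofMapLEIff F hle
  exact ⟨RelIso.ofSurjective e hsurj, fun T => ⟨_, pb T.1⟩⟩
end

section
/- Let C be a coarse object of a q-topos and let m : C → A be a monomorphism. Then m is a strong monomorphism. -/
open CategoryTheory CategoryTheory.Limits

universe w v u

namespace QToposPaper

theorem kernelPair_strongEquivRel {C : Type u} [Category.{v} C] [HasFiniteLimits C]
    {P Q : C} (e : P ⟶ Q) :
    IsStrongEquivRel (pullback.fst e e) (pullback.snd e e) where
  strongMono := by
    have hmono : Mono (prod.lift (pullback.fst e e) (pullback.snd e e)) := by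
      constructor
      intro Z a b hab
      have h1 := congrArg (fun k => k ≫ prod.fst) hab
      have h2 := congrArg (fun k => k ≫ prod.snd) hab
      simp only [Category.assoc, prod.lift_fst, prod.lift_snd] at h1 h2
      exact pullback.hom_ext h1 h2
    refine StrongMono.mk' ?_
    intro A B f hf u v sq
    have h1 := congrArg (fun k => k ≫ prod.fst) sq.w
    have h2 := congrArg (fun k => k ≫ prod.snd) sq.w
    simp only [Category.assoc, prod.lift_fst, prod.lift_snd] at h1 h2
    have hw : (v ≫ prod.fst) ≫ e = (v ≫ prod.snd) ≫ e := by
      rw [← cancel_epi f]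
      rw [← Category.assoc f (v ≫ prod.fst), ← Category.assoc f (v ≫ prod.snd), ← h1, ← h2,
        Category.assoc, Category.assoc, pullback.condition]
    have hl : pullback.lift _ _ hw ≫ prod.lift (pullback.fst e e) (pullback.snd e e) = v := by
      apply prod.hom_ext <;> simp only [Category.assoc, prod.lift_fst, prod.lift_snd, pullback.lift_fst, pullback.lift_snd]
    refine ⟨⟨⟨pullback.lift _ _ hw, ?_, hl⟩⟩⟩
    rw [← cancel_mono (prod.lift (pullback.fst e e) (pullback.snd e e)), Category.assoc, hl, sq.w]
  refl := ⟨pullback.lift (𝟙 P) (𝟙 P) rfl, pullback.lift_fst _ _ _, pullback.lift_snd _ _ _⟩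
  symm := ⟨pullback.lift (pullback.snd e e) (pullback.fst e e) pullback.condition.symm,
    pullback.lift_fst _ _ _, pullback.lift_snd _ _ _⟩
  trans := by
    refine ⟨pullback.lift (pullback.fst _ _ ≫ pullback.fst e e)
      (pullback.snd _ _ ≫ pullback.snd e e) ?_, pullback.lift_fst _ _ _, pullback.lift_snd _ _ _⟩
    rw [Category.assoc, Category.assoc, pullback.condition, ← Category.assoc,
      pullback.condition, Category.assoc, pullback.condition]

theorem exists_epi_of_regularEpi {C : Type u} [Category.{v} C] [HasFiniteLimits C] [QTopos C]
    {P I T : C} (q : P ⟶ I) (hq : Nonempty (RegularEpi q)) (a : T ⟶ I) :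
    ∃ (S : C) (p : S ⟶ T) (x : S ⟶ P), Epi p ∧ p ≫ a = x ≫ q := by
  obtain ⟨r⟩ := QTopos.regularEpiStable _ _ _ _ (IsPullback.of_hasPullback a q) hq
  exact ⟨_, pullback.fst a q, pullback.snd a q, r.epi, pullback.condition⟩

end QToposPaper

open QToposPaper CategoryTheory CategoryTheory.Limits

/-- Let `X` be a coarse object of a q-topos and let `m : X ⟶ A` be a monomorphism.
Then `m` is a strong monomorphism. -/
theorem coarse_mono_strongMono
    {C : Type u} [Category.{v} C] [HasFiniteLimits C] [QTopos C]
    {X A : C} (hX : Coarse X) (m : X ⟶ A) (hm : Mono m) :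
    StrongMono m := by
  refine StrongMono.mk' ?_
  intro P Q e he u v sq
  obtain ⟨I, q, w, ⟨hc⟩, -⟩ :=
    QTopos.effectiveQuotient _ _ (kernelPair_strongEquivRel e)
  have hq : Nonempty (RegularEpi q) := ⟨⟨_, _, _, w, hc⟩⟩
  obtain ⟨i, hi⟩ : ∃ i : I ⟶ Q, q ≫ i = e :=
    ⟨hc.desc (Cofork.ofπ e pullback.condition),
      hc.fac (Cofork.ofπ e pullback.condition) WalkingParallelPair.one⟩
  have hu : pullback.fst e e ≫ u = pullback.snd e e ≫ u := by
    rw [← cancel_mono m, Category.assoc, Category.assoc, sq.w, ← Category.assoc,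
      pullback.condition, Category.assoc]
  obtain ⟨u', hu'⟩ : ∃ u' : I ⟶ X, q ≫ u' = u :=
    ⟨hc.desc (Cofork.ofπ u hu), hc.fac (Cofork.ofπ u hu) WalkingParallelPair.one⟩
  have himono : Mono i := by
    constructor
    intro T a b hab
    obtain ⟨T₁, p₁, x, hp₁, hx⟩ := exists_epi_of_regularEpi q hq a
    obtain ⟨T₂, p₂, y, hp₂, hy⟩ := exists_epi_of_regularEpi q hq (p₁ ≫ b)
    have hxy : (p₂ ≫ x) ≫ e = y ≫ e := by
      rw [← hi, ← Category.assoc y, ← hy, Category.assoc, ← Category.assoc x, ← hx]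
      simp only [Category.assoc, hab]
    have hk : (p₂ ≫ x) ≫ q = y ≫ q := by
      have := congrArg (fun k => pullback.lift _ _ hxy ≫ k) w
      simpa only [← Category.assoc, pullback.lift_fst, pullback.lift_snd] using this
    rw [← cancel_epi p₁, ← cancel_epi p₂, hy, ← hk, hx, Category.assoc]
  have hiepi : Epi i := by
    have : Epi (q ≫ i) := by rw [hi]; exact he
    exact epi_of_epi q i
  obtain ⟨h, hh⟩ := hX i himono hiepi u'
  have heh : e ≫ h = u := by rw [← hi, Category.assoc, hh, hu']
  refine ⟨⟨⟨h, heh, ?_⟩⟩⟩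
  rw [← cancel_epi e, ← Category.assoc, heh, sq.w]
end

section
/- Let C be a coarse object of a q-topos and let m : U ↣ C be a strong monomorphism. Then U is coarse. -/
open CategoryTheory CategoryTheory.Limits

universe w v u

open QToposPaper CategoryTheory CategoryTheory.Limits

/-- Let `X` be a coarse object of a q-topos and let `m : U ⟶ X` be a strong monomorphism.
Then `U` is coarse. -/
theorem coarse_of_strongMono_into_coarse
    {C : Type u} [Category.{v} C] [HasFiniteLimits C] [QTopos C]
    {U X : C} (hX : Coarse X) (m : U ⟶ X) (hm : StrongMono m) :
    Coarse U := by
  intro A B f hf he g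
  obtain ⟨h, hh⟩ := hX f hf he (g ≫ m)
  haveI := hm.rlp f
  have sq : CommSq g f m h := ⟨hh.symm⟩
  exact ⟨sq.lift, sq.fac_left⟩
end

section
/- Let F : B → C be an oplax functor between bicategories such that every unit constraint F(id_a) ⟶ id_{F a} is invertible and the composition constraint F(g ∘ f) ⟶ F g ∘ F f is invertible whenever the 1-cell g admits a right adjoint. Then for any adjunction (f ⊣ u : b → a, η, ε) in B, the 1-cells F f and F u form an adjunction F f ⊣ F u in C, with unit φ_{u,f} ∘ F η ∘ φ_{id_a}⁻¹ and counit φ_{id_b} ∘ F ε ∘ φ_{f,u}⁻¹ (where φ denotes the identity and composition constraints of F). Moreover, if the counit ε is invertible, then so is the counit of the image adjunction. -/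
open CategoryTheory CategoryTheory.Limits

universe w v u

open CategoryTheory CategoryTheory.Bicategory

universe w₁ w₂ v₁ v₂ u₁ u₂

/-- Let `F : B ⥤ᵒᵖˡᵃˣ C` be an oplax functor between bicategories whose unit constraints
`F.mapId a : F.map (𝟙 a) ⟶ 𝟙 (F.obj a)` are all invertible and whose composition constraints
`F.mapComp p q : F.map (p ≫ q) ⟶ F.map p ≫ F.map q` are invertible whenever `q` admits a
right adjoint.  Then the image under `F` of any adjunction `f ⊣ u` in `B` is an adjunction
`F.map f ⊣ F.map u` in `C`, whose unit is `(F.mapId a)⁻¹ ≫ F.map₂ adj.unit ≫ F.mapComp f u`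
and whose counit is `(F.mapComp u f)⁻¹ ≫ F.map₂ adj.counit ≫ F.mapId b` (here expressed
without inverses); moreover if the counit of `f ⊣ u` is invertible then so is the counit of
the image adjunction. -/
theorem oplaxFunctor_map_adjunction
    {B : Type u₁} {C : Type u₂} [Bicategory.{w₁, v₁} B] [Bicategory.{w₂, v₂} C]
    (F : OplaxFunctor B C)
    (hId : ∀ a : B, IsIso (F.mapId a))
    (hComp : ∀ {x y z : B} (p : x ⟶ y) (q : y ⟶ z),
      (∃ r : z ⟶ y, Nonempty (Bicategory.Adjunction q r)) → IsIso (F.mapComp p q))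
    {a b : B} {f : a ⟶ b} {u : b ⟶ a} (adj : Bicategory.Adjunction f u) :
    ∃ adj' : Bicategory.Adjunction (F.map f) (F.map u),
      (F.mapId a ≫ adj'.unit = F.map₂ adj.unit ≫ F.mapComp f u) ∧
      (F.mapComp u f ≫ adj'.counit = F.map₂ adj.counit ≫ F.mapId b) ∧
      (IsIso adj.counit → IsIso adj'.counit) := by
  have hf : ∀ {x : B} (p : x ⟶ a), IsIso (F.mapComp p f) := fun p => hComp p f ⟨u, ⟨adj⟩⟩
  have h1 : ∀ {x y : B} (p : x ⟶ y), IsIso (F.mapComp p (𝟙 y)) :=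
    fun p => hComp p _ ⟨_, ⟨Bicategory.Adjunction.id _⟩⟩
  have hl : adj.unit ▷ f ≫ (α_ f u f).hom ≫ f ◁ adj.counit = (λ_ f).hom ≫ (ρ_ f).inv := by
    rw [← adj.left_triangle]; bicategory
  have hr : u ◁ adj.unit ≫ (α_ u f u).inv ≫ adj.counit ▷ u = (ρ_ u).hom ≫ (λ_ u).inv := by
    rw [← adj.right_triangle]; bicategory
  obtain ⟨η, hη⟩ : ∃ η : 𝟙 (F.obj a) ⟶ F.map f ≫ F.map u,
      F.mapId a ≫ η = F.map₂ adj.unit ≫ F.mapComp f u :=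
    ⟨inv (F.mapId a) ≫ F.map₂ adj.unit ≫ F.mapComp f u, by simp⟩
  obtain ⟨cou, hcou⟩ : ∃ cou : F.map u ≫ F.map f ⟶ 𝟙 (F.obj b),
      F.mapComp u f ≫ cou = F.map₂ adj.counit ≫ F.mapId b :=
    ⟨inv (F.mapComp u f) ≫ F.map₂ adj.counit ≫ F.mapId b, by simp⟩
  refine ⟨⟨η, cou, ?_, ?_⟩, hη, hcou, ?_⟩
  · have e : leftZigzag η cou = η ▷ F.map f ≫ (α_ _ _ _).hom ≫ F.map f ◁ cou := by bicategory
    rw [e, ← cancel_epi (F.mapComp (𝟙 a) f ≫ F.mapId a ▷ F.map f)]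
    calc
      _ = F.mapComp (𝟙 a) f ≫ (F.mapId a ≫ η) ▷ F.map f ≫ (α_ _ _ _).hom ≫ F.map f ◁ cou := by
        simp only [comp_whiskerRight, Category.assoc]
      _ = F.map₂ (adj.unit ▷ f) ≫ (F.mapComp (f ≫ u) f ≫ F.mapComp f u ▷ F.map f ≫
            (α_ (F.map f) (F.map u) (F.map f)).hom) ≫ F.map f ◁ cou := by
        rw [hη, comp_whiskerRight]
        simp only [Category.assoc]
        rw [← F.mapComp_naturality_left_assoc]
      _ = F.map₂ (adj.unit ▷ f) ≫ F.map₂ (α_ f u f).hom ≫ F.mapComp f (u ≫ f) ≫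
            F.map f ◁ (F.mapComp u f ≫ cou) := by
        rw [← F.map₂_associator]
        simp only [Category.assoc, Bicategory.whiskerLeft_comp]
      _ = F.map₂ (adj.unit ▷ f ≫ (α_ f u f).hom ≫ f ◁ adj.counit) ≫
            F.mapComp f (𝟙 b) ≫ F.map f ◁ F.mapId b := by
        rw [hcou, Bicategory.whiskerLeft_comp, ← F.mapComp_naturality_right_assoc]
        simp only [PrelaxFunctor.map₂_comp, Category.assoc]
      _ = F.map₂ (λ_ f).hom ≫ (ρ_ (F.map f)).inv := by
        rw [hl, F.mapComp_id_right, ← F.map₂_comp_assoc]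
        simp only [Category.assoc, Iso.inv_hom_id, Category.comp_id]
      _ = _ := by
        rw [F.map₂_leftUnitor]
        simp only [Category.assoc]
  · have e : rightZigzag η cou = F.map u ◁ η ≫ (α_ _ _ _).inv ≫ cou ▷ F.map u := by bicategory
    rw [e, ← cancel_epi (F.mapComp u (𝟙 a) ≫ F.map u ◁ F.mapId a)]
    calc
      _ = F.mapComp u (𝟙 a) ≫ F.map u ◁ (F.mapId a ≫ η) ≫ (α_ _ _ _).inv ≫ cou ▷ F.map u := by
        simp only [Bicategory.whiskerLeft_comp, Category.assoc]
      _ = F.map₂ (u ◁ adj.unit) ≫ (F.mapComp u (f ≫ u) ≫ F.map u ◁ F.mapComp f u) ≫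
            (α_ (F.map u) (F.map f) (F.map u)).inv ≫ cou ▷ F.map u := by
        rw [hη, Bicategory.whiskerLeft_comp]
        simp only [Category.assoc]
        rw [← F.mapComp_naturality_right_assoc]
      _ = F.map₂ (u ◁ adj.unit) ≫ F.map₂ (α_ u f u).inv ≫ F.mapComp (u ≫ f) u ≫
            (F.mapComp u f ≫ cou) ▷ F.map u := by
        rw [F.mapComp_assoc_right]
        simp only [Category.assoc, comp_whiskerRight, Iso.hom_inv_id_assoc]
      _ = F.map₂ (u ◁ adj.unit ≫ (α_ u f u).inv ≫ adj.counit ▷ u) ≫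
            F.mapComp (𝟙 b) u ≫ F.mapId b ▷ F.map u := by
        rw [hcou, comp_whiskerRight, ← F.mapComp_naturality_left_assoc]
        simp only [PrelaxFunctor.map₂_comp, Category.assoc]
      _ = F.map₂ (ρ_ u).hom ≫ (λ_ (F.map u)).inv := by
        rw [hr, F.mapComp_id_left, ← F.map₂_comp_assoc]
        simp only [Category.assoc, Iso.inv_hom_id, Category.comp_id]
      _ = _ := by
        rw [F.map₂_rightUnitor]
        simp only [Category.assoc]
  · intro hc
    have : IsIso (F.map₂ adj.counit) :=
      inferInstanceAs (IsIso ((F.mapFunctor _ _).map adj.counit))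
    have h2 : IsIso (F.mapComp u f ≫ cou) := by rw [hcou]; infer_instance
    exact IsIso.of_isIso_comp_left (F.mapComp u f) cou
end

section
/- In a q-topos, for every object A the poset StrongSub(A) of strong subobjects of A is a Heyting algebra: it has finite meets, finite joins, and a binary operation ⇒ satisfying φ ∧ ψ ≤ γ iff φ ≤ ψ ⇒ γ. -/
open CategoryTheory CategoryTheory.Limits

universe w v u

open QToposPaper CategoryTheory CategoryTheory.Limits

namespace QToposAux

variable {C : Type u} [Category.{v} C]

lemma fac_iff {A X : C} (S : Subobject A) (f : X ⟶ A) :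
    S.Factors f ↔ ∃ g, g ≫ S.arrow = f :=
  ⟨fun h => ⟨S.factorThru f h, S.factorThru_arrow f h⟩, by
    rintro ⟨g, rfl⟩; exact Subobject.factors_comp_arrow g⟩

lemma le_of_fac {A : C} {S T : Subobject A}
    (h : ∀ (X : C) (f : X ⟶ A), S.Factors f → T.Factors f) : S ≤ T := by
  obtain ⟨g, hg⟩ := (fac_iff _ _).1 (h _ S.arrow S.factors_self)
  exact Subobject.le_of_comm g hg

lemma strong_iff {A : C} (S : Subobject A) :
    StrongMono S.arrow ↔ ∀ (X Y : C) (z : X ⟶ Y) (f : Y ⟶ A), Epi z →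
      S.Factors (z ≫ f) → S.Factors f := by
  constructor
  · intro hS X Y z f hz h
    obtain ⟨g, hg⟩ := (fac_iff _ _).1 h
    have := hS.rlp z
    have sq : CommSq g z S.arrow f := ⟨hg⟩
    exact (fac_iff _ _).2 ⟨sq.lift, sq.fac_right⟩
  · intro h
    refine ⟨inferInstance, ?_⟩
    intro X Y z hz
    refine ⟨?_⟩
    intro f g sq
    have h1 : S.Factors (z ≫ g) := (fac_iff _ _).2 ⟨f, sq.w⟩
    obtain ⟨l, hl⟩ := (fac_iff _ _).1 (h _ _ z g hz h1)
    refine ⟨⟨⟨l, ?_, hl⟩⟩⟩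
    rw [← cancel_mono S.arrow, Category.assoc, hl, sq.w]

lemma pullback_fac [HasPullbacks C] {A B X : C} (k : A ⟶ B) (S : Subobject B) (f : X ⟶ A) :
    ((Subobject.pullback k).obj S).Factors f ↔ S.Factors (f ≫ k) := by
  have hp := Subobject.isPullback k S
  rw [fac_iff, fac_iff]
  constructor
  · rintro ⟨g, rfl⟩
    exact ⟨g ≫ Subobject.pullbackπ k S, by simp [hp.w]⟩
  · rintro ⟨g, hg⟩
    exact ⟨hp.lift g f hg, by simp⟩

/-- generalized element membership -/
def El {A X : C} (S : StrongSub A) (f : X ⟶ A) : Prop := S.1.Factors f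

lemma El.pre {A X Y : C} {S : StrongSub A} {f : X ⟶ A} (h : El S f) (y : Y ⟶ X) :
    El S (y ≫ f) := Subobject.factors_of_factors_right y h

lemma le_iff {A : C} {S T : StrongSub A} :
    S ≤ T ↔ ∀ (X : C) (f : X ⟶ A), El S f → El T f :=
  ⟨fun h _ f hf => Subobject.factors_of_le f h hf, fun h => le_of_fac h⟩

lemma exists_top (A : C) : ∃ T : StrongSub A, ∀ (X : C) (f : X ⟶ A), El T f :=
  ⟨⟨⊤, (strong_iff _).2 fun _ _ _ _ _ _ => Subobject.top_factors _⟩,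
    fun _ f => Subobject.top_factors f⟩

lemma exists_pullback [HasPullbacks C] {A B : C} (k : A ⟶ B) (S : StrongSub B) :
    ∃ T : StrongSub A, ∀ (X : C) (f : X ⟶ A), El T f ↔ El S (f ≫ k) := by
  refine ⟨⟨(Subobject.pullback k).obj S.1, (strong_iff _).2 ?_⟩, fun X f => pullback_fac k S.1 f⟩
  intro X Y z f hz h
  rw [pullback_fac] at h ⊢
  exact (strong_iff _).1 S.2 _ _ z _ hz (by simpa using h)

lemma exists_inf [HasPullbacks C] {A : C} (S T : StrongSub A) :
    ∃ I : StrongSub A, ∀ (X : C) (f : X ⟶ A), El I f ↔ El S f ∧ El T f := by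
  refine ⟨⟨S.1 ⊓ T.1, (strong_iff _).2 ?_⟩, fun X f => Subobject.inf_factors f⟩
  intro X Y z f hz h
  rw [Subobject.inf_factors] at h ⊢
  exact ⟨(strong_iff _).1 S.2 _ _ z _ hz h.1, (strong_iff _).1 T.2 _ _ z _ hz h.2⟩

lemma exists_eq [HasEqualizers C] {A B : C} (k l : A ⟶ B) :
    ∃ I : StrongSub A, ∀ (X : C) (f : X ⟶ A), El I f ↔ f ≫ k = f ≫ l := by
  have key : ∀ (X : C) (f : X ⟶ A), (equalizerSubobject k l).Factors f ↔ f ≫ k = f ≫ l :=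
    fun X f => equalizerSubobject_factors_iff k l f
  refine ⟨⟨equalizerSubobject k l, (strong_iff _).2 ?_⟩, key⟩
  intro X Y z f hz h
  rw [key] at h ⊢
  rw [← cancel_epi z]
  simpa using h

variable [HasFiniteLimits C] [QTopos C]

lemma isPullback_iff {A X P E : C} {mem : E ⟶ P ⨯ A} [Mono mem] (S : Subobject (X ⨯ A))
    (χ : X ⟶ P) :
    (∃ top : (S : C) ⟶ E, IsPullback top S.arrow mem (prod.map χ (𝟙 A))) ↔
    ∀ (Y : C) (y : Y ⟶ X) (a : Y ⟶ A),
      S.Factors (prod.lift y a) ↔ (Subobject.mk mem).Factors (prod.lift (y ≫ χ) a) := by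
  have hmem : ∀ (Y : C) (f : Y ⟶ P ⨯ A),
      (Subobject.mk mem).Factors f ↔ ∃ g : Y ⟶ E, g ≫ mem = f := by
    intro Y f
    rw [fac_iff]
    constructor
    · rintro ⟨g, rfl⟩
      exact ⟨g ≫ (Subobject.underlyingIso mem).hom, by simp⟩
    · rintro ⟨g, rfl⟩
      exact ⟨g ≫ (Subobject.underlyingIso mem).inv, by simp⟩
  constructor
  · rintro ⟨top, hp⟩ Y y a
    rw [hmem, fac_iff]
    constructor
    · rintro ⟨g, hg⟩
      refine ⟨g ≫ top, ?_⟩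
      rw [Category.assoc, hp.w, ← Category.assoc, hg]
      simp
    · rintro ⟨g, hg⟩
      exact ⟨hp.lift g (prod.lift y a) (by simp [hg]), by simp⟩
  · intro h
    have e : ∀ {Y : C} (f : Y ⟶ X ⨯ A), prod.lift ((f ≫ prod.fst) ≫ χ) (f ≫ prod.snd)
        = f ≫ prod.map χ (𝟙 A) := by
      intro Y f
      apply Limits.prod.hom_ext
      · rw [prod.lift_fst, Category.assoc, Category.assoc, prod.map_fst]
      · rw [prod.lift_snd, Category.assoc, prod.map_snd, Category.comp_id]
    have e' : ∀ {Y : C} (f : Y ⟶ X ⨯ A), prod.lift (f ≫ prod.fst) (f ≫ prod.snd) = f := by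
      intro Y f
      apply Limits.prod.hom_ext
      · rw [prod.lift_fst]
      · rw [prod.lift_snd]
    have h' : ∀ {Y : C} (f : Y ⟶ X ⨯ A), S.Factors f ↔ ∃ g : Y ⟶ E, g ≫ mem = f ≫ prod.map χ (𝟙 A) := by
      intro Y f
      have := h Y (f ≫ prod.fst) (f ≫ prod.snd)
      rwa [hmem, e, e'] at this
    obtain ⟨t, ht⟩ := (h' S.arrow).1 S.factors_self
    refine ⟨t, ⟨ht⟩, ⟨PullbackCone.IsLimit.mk _ (fun s => ?_) ?_ ?_ ?_⟩⟩
    · exact S.factorThru s.snd ((h' s.snd).2 ⟨s.fst, s.condition⟩)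
    · intro s
      rw [← cancel_mono mem, Category.assoc, ht, ← Category.assoc, Subobject.factorThru_arrow,
        s.condition]
    · intro s
      simp
    · intro s m h1 h2
      rw [← cancel_mono S.arrow, h2]
      simp

lemma exists_power (A : C) : ∃ (P : C) (M : StrongSub (P ⨯ A)),
    (∀ (X : C) (S : StrongSub (X ⨯ A)), ∃ χ : X ⟶ P, ∀ (Y : C) (y : Y ⟶ X) (a : Y ⟶ A),
      El S (prod.lift y a) ↔ El M (prod.lift (y ≫ χ) a)) ∧
    (∀ (X : C) (k l : X ⟶ P), (∀ (Y : C) (y : Y ⟶ X) (a : Y ⟶ A),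
      El M (prod.lift (y ≫ k) a) ↔ El M (prod.lift (y ≫ l) a)) → k = l) := by
  obtain ⟨P, E, mem, hs, hu⟩ := QTopos.weakPowerObject A
  have hm : Mono mem := hs.mono
  have hM : StrongMono (Subobject.mk mem).arrow := by
    rw [← Subobject.underlyingIso_hom_comp_eq_mk mem]
    have : StrongMono (Subobject.underlyingIso mem).hom := inferInstance
    exact strongMono_comp _ _
  refine ⟨P, ⟨Subobject.mk mem, hM⟩, ?_, ?_⟩
  · intro X S
    obtain ⟨χ, hχ, -⟩ := hu S.1.arrow S.2
    exact ⟨χ, (isPullback_iff S.1 χ).1 hχ⟩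
  · intro X k l h
    obtain ⟨S, hS⟩ := exists_pullback (prod.map k (𝟙 A))
      (⟨Subobject.mk mem, hM⟩ : StrongSub (P ⨯ A))
    have h1 : ∀ (Y : C) (y : Y ⟶ X) (a : Y ⟶ A),
        El S (prod.lift y a) ↔ (Subobject.mk mem).Factors (prod.lift (y ≫ k) a) := by
      intro Y y a
      rw [hS, prod.lift_map, Category.comp_id]; rfl
    exact (hu S.1.arrow S.2).unique ((isPullback_iff S.1 k).2 h1)
      ((isPullback_iff S.1 l).2 fun Y y a => (h1 Y y a).trans (h Y y a))

lemma exists_classifier : ∃ (Ω : C) (T : StrongSub Ω),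
    (∀ (X : C) (S : StrongSub X), ∃ χ : X ⟶ Ω, ∀ (Y : C) (y : Y ⟶ X),
      El S y ↔ El T (y ≫ χ)) ∧
    (∀ (X : C) (k l : X ⟶ Ω), (∀ (Y : C) (y : Y ⟶ X),
      El T (y ≫ k) ↔ El T (y ≫ l)) → k = l) := by
  obtain ⟨P, M, h1, h2⟩ := exists_power (⊤_ C)
  obtain ⟨T, hT⟩ := exists_pullback (prod.lift (𝟙 P) (terminal.from P)) M
  have hT' : ∀ (Y : C) (y : Y ⟶ P) (a : Y ⟶ ⊤_ C), El M (prod.lift y a) ↔ El T y := by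
    intro Y y a
    rw [hT, prod.comp_lift, Category.comp_id, Subsingleton.elim (y ≫ terminal.from P) a]
  refine ⟨P, T, ?_, ?_⟩
  · intro X S
    obtain ⟨S', hS'⟩ := exists_pullback (prod.fst : X ⨯ ⊤_ C ⟶ X) S
    obtain ⟨χ, hχ⟩ := h1 X S'
    refine ⟨χ, fun Y y => ?_⟩
    have := hχ Y y (terminal.from Y)
    rwa [hS', hT', prod.lift_fst] at this
  · intro X k l h
    apply h2
    intro Y y a
    rw [hT', hT']
    exact h Y y

lemma exists_imp {A : C} (S T : StrongSub A) : ∃ I : StrongSub A, ∀ (X : C) (f : X ⟶ A),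
    El I f ↔ ∀ (Y : C) (y : Y ⟶ X), El S (y ≫ f) → El T (y ≫ f) := by
  obtain ⟨Ω, t, h1, h2⟩ := exists_classifier (C := C)
  obtain ⟨J, hJ⟩ := exists_inf S T
  obtain ⟨k, hk⟩ := h1 A J
  obtain ⟨l, hl⟩ := h1 A S
  obtain ⟨I, hI⟩ := exists_eq k l
  refine ⟨I, fun X f => ?_⟩
  rw [hI]
  constructor
  · intro h Y y hy
    have : El J (y ≫ f) := by
      rw [hk, Category.assoc, h, ← Category.assoc, ← hl]; exact hy
    exact ((hJ _ _).1 this).2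
  · intro h
    apply h2
    intro Y y
    rw [← Category.assoc, ← hk, ← Category.assoc, ← hl, hJ]
    exact ⟨fun h => h.1, fun h' => ⟨h', h Y y h'⟩⟩

lemma exists_all {A B : C} (S : StrongSub (A ⨯ B)) : ∃ I : StrongSub A, ∀ (X : C) (f : X ⟶ A),
    El I f ↔ ∀ (Y : C) (y : Y ⟶ X) (b : Y ⟶ B), El S (prod.lift (y ≫ f) b) := by
  obtain ⟨P, M, h1, h2⟩ := exists_power B
  obtain ⟨T, hT⟩ := exists_top (A ⨯ B)
  obtain ⟨k, hk⟩ := h1 A S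
  obtain ⟨l, hl⟩ := h1 A T
  obtain ⟨I, hI⟩ := exists_eq k l
  refine ⟨I, fun X f => ?_⟩
  rw [hI]
  constructor
  · intro h Y y b
    rw [hk, Category.assoc, h, ← Category.assoc, ← hl]
    exact hT _ _
  · intro h
    apply h2
    intro Y y b
    rw [← Category.assoc, ← hk, ← Category.assoc, ← hl]
    exact ⟨fun _ => hT _ _, fun _ => h Y y b⟩

lemma exists_bot (A : C) : ∃ B : StrongSub A, ∀ S : StrongSub A, B ≤ S := by
  obtain ⟨Ω, t, h1, h2⟩ := exists_classifier (C := C)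
  obtain ⟨T, hT⟩ := exists_pullback (prod.snd : A ⨯ Ω ⟶ Ω) t
  obtain ⟨I, hI⟩ := exists_all T
  refine ⟨I, fun S => le_iff.2 fun X f hf => ?_⟩
  obtain ⟨χ, hχ⟩ := h1 A S
  have := (hI X f).1 hf X (𝟙 X) (f ≫ χ)
  rw [hT, prod.lift_snd] at this
  exact (hχ _ _).2 this

lemma exists_sup {A : C} (S T : StrongSub A) :
    ∃ J : StrongSub A, S ≤ J ∧ T ≤ J ∧ ∀ U : StrongSub A, S ≤ U → T ≤ U → J ≤ U := by
  obtain ⟨Ω, t, h1, h2⟩ := exists_classifier (C := C)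
  obtain ⟨W, hW⟩ := exists_pullback (prod.snd : A ⨯ Ω ⟶ Ω) t
  obtain ⟨S', hS'⟩ := exists_pullback (prod.fst : A ⨯ Ω ⟶ A) S
  obtain ⟨T', hT'⟩ := exists_pullback (prod.fst : A ⨯ Ω ⟶ A) T
  obtain ⟨S1, hS1⟩ := exists_imp S' W
  obtain ⟨T1, hT1⟩ := exists_imp T' W
  obtain ⟨K, hK⟩ := exists_inf S1 T1
  obtain ⟨L, hL⟩ := exists_imp K W
  obtain ⟨J, hJ⟩ := exists_all L
  refine ⟨J, ?_, ?_, ?_⟩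
  · refine le_iff.2 fun X f hf => (hJ _ _).2 fun Y y b => (hL _ _).2 fun Z z hz => ?_
    have h := (hS1 _ _).1 ((hK _ _).1 hz).1 Z (𝟙 Z)
    rw [Category.id_comp] at h
    apply h
    rw [hS', Category.assoc, prod.lift_fst]
    exact (hf.pre y).pre z
  · refine le_iff.2 fun X f hf => (hJ _ _).2 fun Y y b => (hL _ _).2 fun Z z hz => ?_
    have h := (hT1 _ _).1 ((hK _ _).1 hz).2 Z (𝟙 Z)
    rw [Category.id_comp] at h
    apply h
    rw [hT', Category.assoc, prod.lift_fst]
    exact (hf.pre y).pre z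
  · intro U hSU hTU
    refine le_iff.2 fun X f hf => ?_
    obtain ⟨χ, hχ⟩ := h1 A U
    have h := (hL _ _).1 ((hJ _ _).1 hf X (𝟙 X) (f ≫ χ)) X (𝟙 X)
    simp only [Category.id_comp] at h
    have h3 : El W (prod.lift f (f ≫ χ)) := by
      apply h
      rw [hK, hS1, hT1]
      constructor
      · intro Y y hy
        rw [hS', Category.assoc, prod.lift_fst] at hy
        rw [hW, Category.assoc, prod.lift_snd, ← Category.assoc, ← hχ]
        exact le_iff.1 hSU _ _ hy
      · intro Y y hy
        rw [hT', Category.assoc, prod.lift_fst] at hy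
        rw [hW, Category.assoc, prod.lift_snd, ← Category.assoc, ← hχ]
        exact le_iff.1 hTU _ _ hy
    rw [hW, prod.lift_snd] at h3
    exact (hχ _ _).2 h3

end QToposAux

/-- In a q-topos, for every object `A` the poset `StrongSub A` of strong subobjects of `A`
is a Heyting algebra: it has finite meets (binary meets and a top element), finite joins
(binary joins and a bottom element), and a binary operation `himp` satisfying
`φ ⊓ ψ ≤ γ ↔ φ ≤ ψ ⇨ γ`. -/
theorem strongSub_heytingAlgebra
    {C : Type u} [Category.{v} C] [HasFiniteLimits C] [QTopos C] (A : C) :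
    ∃ (inf sup himp : StrongSub A → StrongSub A → StrongSub A)
      (top bot : StrongSub A),
      (∀ x y : StrongSub A, IsGLB {x, y} (inf x y)) ∧
      (∀ x y : StrongSub A, IsLUB {x, y} (sup x y)) ∧
      IsTop top ∧ IsBot bot ∧
      (∀ φ ψ γ : StrongSub A, inf φ ψ ≤ γ ↔ φ ≤ himp ψ γ) := by
  choose inf hinf using fun x y : StrongSub A => QToposAux.exists_inf x y
  choose sup hsup using fun x y : StrongSub A => QToposAux.exists_sup x y
  choose imp himp using fun x y : StrongSub A => QToposAux.exists_imp x y
  obtain ⟨top, htop⟩ := QToposAux.exists_top A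
  obtain ⟨bot, hbot⟩ := QToposAux.exists_bot A
  refine ⟨inf, sup, imp, top, bot, ?_, ?_, ?_, hbot, ?_⟩
  · intro x y
    constructor
    · rintro z (rfl | rfl)
      · exact QToposAux.le_iff.2 fun X f hf => ((hinf _ _ _ _).1 hf).1
      · exact QToposAux.le_iff.2 fun X f hf => ((hinf _ _ _ _).1 hf).2
    · intro z hz
      exact QToposAux.le_iff.2 fun X f hf => (hinf _ _ _ _).2
        ⟨QToposAux.le_iff.1 (hz (Or.inl rfl)) X f hf, QToposAux.le_iff.1 (hz (Or.inr rfl)) X f hf⟩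
  · intro x y
    constructor
    · rintro z (rfl | rfl)
      · exact (hsup _ _).1
      · exact (hsup _ _).2.1
    · intro z hz
      exact (hsup x y).2.2 z (hz (Or.inl rfl)) (hz (Or.inr rfl))
  · exact fun x => QToposAux.le_iff.2 fun X f _ => htop X f
  · intro φ ψ γ
    constructor
    · intro h
      exact QToposAux.le_iff.2 fun X f hf => (himp _ _ _ _).2 fun Y y hy =>
        QToposAux.le_iff.1 h _ _ ((hinf _ _ _ _).2 ⟨hf.pre y, hy⟩)
    · intro h
      refine QToposAux.le_iff.2 fun X f hf => ?_
      obtain ⟨h1, h2⟩ := (hinf _ _ _ _).1 hf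
      have h3 := (himp _ _ _ _).1 (QToposAux.le_iff.1 h _ _ h1) X (𝟙 X)
      rw [Category.id_comp] at h3
      exact h3 h2
end
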